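/- Let A ⊆ B ⊆ ℕ^m be positive affine semigroups with C(A) = C(B), and set B_A := {x ∈ B : x ∉ B + (A ∖ {0})}. Then every coset of G(A) in G(B) contains an element of B_A; that is, the composition B_A → G(B) → G(B)/G(A) is surjective. -/

import Mathlib

open Pointwise

noncomputable section

/-- Coordinatewise cast `ℕ^m → ℚ^m`. -/
def natCastQ {m : ℕ} (x : Fin m → ℕ) : Fin m → ℚ := fun i => (x i : ℚ)

/-- Coordinatewise cast `ℕ^m → ℤ^m`. -/
def natCastZ {m : ℕ} (x : Fin m → ℕ) : Fin m → ℤ := fun i => (x i : ℤ)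

/-- Coordinatewise cast `ℤ^m → ℚ^m`. -/
def intCastQ {m : ℕ} (x : Fin m → ℤ) : Fin m → ℚ := fun i => (x i : ℚ)

/-- The rational convex cone spanned by a subset of `ℕ^m` inside `ℚ^m`. -/
def ratCone {m : ℕ} (X : Set (Fin m → ℕ)) : Set (Fin m → ℚ) :=
  {y | ∃ (k : ℕ) (q : Fin k → ℚ) (x : Fin k → (Fin m → ℕ)),
    (∀ i, 0 ≤ q i) ∧ (∀ i, x i ∈ X) ∧ y = ∑ i, q i • natCastQ (x i)}

/-- `B_A = {x ∈ B : x ∉ B + (A ∖ {0})}`. -/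
def BA {m : ℕ} (A B : AddSubmonoid (Fin m → ℕ)) : Set (Fin m → ℕ) :=
  {x | x ∈ B ∧ x ∉ (B : Set (Fin m → ℕ)) + ((A : Set (Fin m → ℕ)) \ {0})}

/-- The subgroup of `ℤ^m` generated by a subset of `ℕ^m`. -/
def grpZ {m : ℕ} (X : Set (Fin m → ℕ)) : AddSubgroup (Fin m → ℤ) :=
  AddSubgroup.closure (natCastZ '' X)

theorem natCastZ_add {m : ℕ} (x y : Fin m → ℕ) :
    natCastZ (x + y) = natCastZ x + natCastZ y := by
  ext i; simp [natCastZ]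

theorem natCastZ_mem_grpZ {m : ℕ} {X : Set (Fin m → ℕ)} {x : Fin m → ℕ} (hx : x ∈ X) :
    natCastZ x ∈ grpZ X :=
  AddSubgroup.subset_closure ⟨x, hx, rfl⟩

/-- A nonnegative rational combination of elements of a submonoid has a positive integer multiple
in the submonoid. -/
theorem exists_nsmul_sum_eq_natCastQ {m : ℕ} (A : AddSubmonoid (Fin m → ℕ)) {ι : Type*}
    (s : Finset ι) (q : ι → ℚ) (x : ι → (Fin m → ℕ)) (hq : ∀ i, 0 ≤ q i) (hx : ∀ i, x i ∈ A) :
    ∃ n : ℕ, 0 < n ∧ ∃ a ∈ A, n • ∑ i ∈ s, q i • natCastQ (x i) = natCastQ a := by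
  classical
  induction s using Finset.induction_on with
  | empty => exact ⟨1, one_pos, 0, A.zero_mem, by ext; simp [natCastQ]⟩
  | insert j s hj ih =>
    obtain ⟨n, hn, a, ha, h⟩ := ih
    refine ⟨n * (q j).den, Nat.mul_pos hn (q j).den_pos,
      (n * (q j).num.toNat) • x j + (q j).den • a,
      A.add_mem (A.nsmul_mem (hx j) _) (A.nsmul_mem ha _), ?_⟩
    have hnum : (((q j).num.toNat : ℕ) : ℚ) = q j * (q j).den := by
      rw [Rat.mul_den_eq_num]
      exact_mod_cast Int.toNat_of_nonneg (Rat.num_nonneg.mpr (hq j))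
    rw [Finset.sum_insert hj]
    ext i
    have hi := congrFun h i
    simp only [natCastQ, Pi.smul_apply, Pi.add_apply, nsmul_eq_mul, smul_eq_mul, Nat.cast_add,
      Nat.cast_mul, Pi.mul_apply, Pi.natCast_apply, hnum, Nat.cast_id] at hi ⊢
    rw [← hi]
    ring

theorem exists_nsmul_mem_of_natCastQ_mem_ratCone {m : ℕ} {A : AddSubmonoid (Fin m → ℕ)}
    {b : Fin m → ℕ} (hb : natCastQ b ∈ ratCone (A : Set (Fin m → ℕ))) :
    ∃ n : ℕ, 0 < n ∧ n • b ∈ A := by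
  obtain ⟨k, q, x, hq, hx, h⟩ := hb
  obtain ⟨n, hn, a, ha, hna⟩ := exists_nsmul_sum_eq_natCastQ A Finset.univ q x hq hx
  refine ⟨n, hn, ?_⟩
  rw [← h] at hna
  convert ha
  ext i
  have hi := congrFun hna i
  simp only [natCastQ, Pi.smul_apply, nsmul_eq_mul] at hi
  simpa using (by exact_mod_cast hi : n * b i = a i)

theorem subset_ratCone {m : ℕ} {X : Set (Fin m → ℕ)} {x : Fin m → ℕ} (hx : x ∈ X) :
    natCastQ x ∈ ratCone X :=
  ⟨1, fun _ => 1, fun _ => x, fun _ => zero_le_one, fun _ => hx, by simp⟩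

/-- If every element of `B` has a positive multiple in `A`, then every element of `G(B)` is
congruent modulo `G(A)` to an element of `B`. -/
theorem exists_mem_sub_mem_grpZ {m : ℕ} {A B : AddSubmonoid (Fin m → ℕ)}
    (h : ∀ b ∈ B, ∃ n : ℕ, 0 < n ∧ n • b ∈ A) {g : Fin m → ℤ}
    (hg : g ∈ grpZ (B : Set (Fin m → ℕ))) :
    ∃ b ∈ B, g - natCastZ b ∈ grpZ (A : Set (Fin m → ℕ)) := by
  induction hg using AddSubgroup.closure_induction with
  | mem g hg =>
    obtain ⟨b, hb, rfl⟩ := hg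
    exact ⟨b, hb, by simp [zero_mem]⟩
  | zero =>
    refine ⟨0, B.zero_mem, ?_⟩
    have h0 : natCastZ (0 : Fin m → ℕ) = 0 := by ext; simp [natCastZ]
    simp [h0, zero_mem]
  | add g₁ g₂ _ _ h₁ h₂ =>
    obtain ⟨b₁, hb₁, h₁⟩ := h₁
    obtain ⟨b₂, hb₂, h₂⟩ := h₂
    refine ⟨b₁ + b₂, B.add_mem hb₁ hb₂, ?_⟩
    rw [natCastZ_add, add_sub_add_comm]
    exact add_mem h₁ h₂
  | neg g _ hg =>
    obtain ⟨b, hb, hg⟩ := hg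
    obtain ⟨n, hn, hnb⟩ := h b hb
    obtain ⟨k, rfl⟩ := Nat.exists_eq_succ_of_ne_zero hn.ne'
    refine ⟨k • b, B.nsmul_mem hb k, ?_⟩
    have hsum := natCastZ_add (k • b) b
    rw [← succ_nsmul] at hsum
    have hmem := add_mem hg (natCastZ_mem_grpZ hnb)
    rw [hsum] at hmem
    convert neg_mem hmem using 1
    abel

/-- For positive affine semigroups `A ⊆ B ⊆ ℕ^m` with `C(A) = C(B)`, every
coset of `G(A)` in `G(B)` contains an element of `B_A`. -/
theorem BA_surjects_onto_cosets {m : ℕ} (A B : AddSubmonoid (Fin m → ℕ)) (hAB : A ≤ B)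
    (hA : A.FG) (hB : B.FG)
    (hC : ratCone (A : Set (Fin m → ℕ)) = ratCone (B : Set (Fin m → ℕ))) :
    ∀ g : grpZ (B : Set (Fin m → ℕ)) ⧸
        (grpZ (A : Set (Fin m → ℕ))).addSubgroupOf (grpZ (B : Set (Fin m → ℕ))),
      ∃ x ∈ BA A B, ∃ hx : natCastZ x ∈ grpZ (B : Set (Fin m → ℕ)),
        (QuotientAddGroup.mk (⟨natCastZ x, hx⟩ : grpZ (B : Set (Fin m → ℕ))) :
          grpZ (B : Set (Fin m → ℕ)) ⧸
            (grpZ (A : Set (Fin m → ℕ))).addSubgroupOf (grpZ (B : Set (Fin m → ℕ)))) = g := by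
  intro g
  obtain ⟨⟨g, hg⟩, rfl⟩ := QuotientAddGroup.mk_surjective g
  have hmul : ∀ b ∈ B, ∃ n : ℕ, 0 < n ∧ n • b ∈ A := fun b hb =>
    exists_nsmul_mem_of_natCastQ_mem_ratCone (hC ▸ subset_ratCone hb)
  obtain ⟨x, ⟨hxB, hxg⟩, hmin⟩ := exists_minimal_of_wellFoundedLT
    (fun b => b ∈ B ∧ g - natCastZ b ∈ grpZ (A : Set (Fin m → ℕ)))
    (exists_mem_sub_mem_grpZ hmul hg)
  refine ⟨x, ⟨hxB, ?_⟩, natCastZ_mem_grpZ hxB, ?_⟩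
  · rintro ⟨b, hb, a, ⟨ha, ha0⟩, rfl⟩
    refine ha0 (nonpos_iff_eq_zero.mp ((add_le_iff_nonpos_right b).mp
      (hmin ⟨hb, ?_⟩ (le_add_of_nonneg_right zero_le))))
    convert add_mem hxg (natCastZ_mem_grpZ ha) using 1
    simp only [natCastZ_add]
    abel
  · rw [QuotientAddGroup.eq, AddSubgroup.mem_addSubgroupOf]
    simpa [sub_eq_neg_add] using hxg
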